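/- In the Migliore construction with α ≥ β + n − 2, if s ≥ β, then the minimum socle degree A_n equals β or β − 1. -/

import Mathlib

open MvPolynomial

noncomputable section

namespace PointsMinDist

variable {K : Type} [Field K]

/-- The (homogeneous) vanishing ideal of a set of points of projective space:
all polynomials vanishing at every representative vector of every point. -/
def vanishingIdeal {m : ℕ} (Γ : Set (Projectivization K (Fin m → K))) :
    Ideal (MvPolynomial (Fin m) K) where
  carrier := {f | ∀ P ∈ Γ, ∀ (v : Fin m → K) (hv : v ≠ 0),
      Projectivization.mk K v hv = P → MvPolynomial.eval v f = 0}
  zero_mem' := by intro P hP v hv h; simp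
  add_mem' := by
    intro f g hf hg P hP v hv h
    simp [hf P hP v hv h, hg P hP v hv h]
  smul_mem' := by
    intro c f hf P hP v hv h
    simp [smul_eq_mul, hf P hP v hv h]

/-- The degree-`d` graded component of a (homogeneous) ideal, as a `K`-subspace. -/
def degPart {m : ℕ} (I : Ideal (MvPolynomial (Fin m) K)) (d : ℕ) :
    Submodule K (MvPolynomial (Fin m) K) :=
  Submodule.restrictScalars K I ⊓ homogeneousSubmodule (Fin m) K d

/-- `K`-dimension of the degree-`d` component of an ideal. -/
def hdim {m : ℕ} (I : Ideal (MvPolynomial (Fin m) K)) (d : ℕ) : ℕ :=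
  Module.finrank K (degPart I d)

/-- Hilbert function of `R/I` in degree `d`. -/
def HF {m : ℕ} (I : Ideal (MvPolynomial (Fin m) K)) (d : ℕ) : ℕ :=
  Module.finrank K (homogeneousSubmodule (Fin m) K d) - hdim I d

open Classical in
/-- `hyp Γ`: the maximum number of points of `Γ` contained in a hyperplane. -/
def hyp {m : ℕ} (Γ : Finset (Projectivization K (Fin m → K))) : ℕ :=
  sSup {k | ∃ φ : Module.Dual K (Fin m → K), φ ≠ 0 ∧
    k = (Γ.filter fun P => φ P.rep = 0).card}

/-- the minimum distance `d(Γ) = |Γ| - hyp(Γ)`. -/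
def minDist {m : ℕ} (Γ : Finset (Projectivization K (Fin m → K))) : ℕ :=
  Γ.card - hyp Γ

/-- `Γ` is non-degenerate: it is not contained in any hyperplane. -/
def Nondeg {m : ℕ} (Γ : Finset (Projectivization K (Fin m → K))) : Prop :=
  ∀ φ : Module.Dual K (Fin m → K), (∀ P ∈ Γ, φ P.rep = 0) → φ = 0

/-- The higher minimum distance `d(Γ)ₐ = |Γ| - max{|Γ'| : Γ' ⊆ Γ, dim I(Γ')ₐ > dim I(Γ)ₐ}`. -/
def higherD {m : ℕ} (Γ : Finset (Projectivization K (Fin m → K))) (a : ℕ) : ℕ :=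
  Γ.card - sSup {k | ∃ Γ' ⊆ Γ,
    hdim (vanishingIdeal (Γ' : Set (Projectivization K (Fin m → K)))) a >
      hdim (vanishingIdeal (Γ : Set (Projectivization K (Fin m → K)))) a ∧ k = Γ'.card}

open Classical in
/-- The degree `δ(P)` of a point `P` in `Γ`: the least degree in which the ideal
of `Γ \ {P}` is strictly bigger than the ideal of `Γ`. -/
def pointDegree {m : ℕ} (Γ : Finset (Projectivization K (Fin m → K)))
    (P : Projectivization K (Fin m → K)) : ℕ :=
  sInf {d | hdim (vanishingIdeal ((Γ.erase P) : Set (Projectivization K (Fin m → K)))) d >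
    hdim (vanishingIdeal (Γ : Set (Projectivization K (Fin m → K)))) d}

/-- A graded minimal free resolution
`0 → F_len → ⋯ → F_1 → R → R/I → 0` of `R/I`, `R = K[x_0,…,x_{N-1}]`.
`F_j = ⊕_{i : Fin (rk j)} R(-(twist j i))` for `1 ≤ j ≤ len`.
The differential `F_1 → R` is given by `gen` (so that its image is `I`) and the
differential `F_{j+2} → F_{j+1}` is given (in matrix form, rows indexed by the
target) by `mat j`.  All entries are homogeneous of the appropriate degrees, and
minimality means all entries lie in the irrelevant maximal ideal
(zero constant coefficient). -/
structure MinFreeRes (N : ℕ) (K : Type) [Field K] (I : Ideal (MvPolynomial (Fin N) K)) where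
  len : ℕ
  rk : ℕ → ℕ
  twist : (j : ℕ) → Fin (rk j) → ℕ
  gen : Fin (rk 1) → MvPolynomial (Fin N) K
  mat : (j : ℕ) → Matrix (Fin (rk (j + 1))) (Fin (rk (j + 2))) (MvPolynomial (Fin N) K)
  rk_len_pos : 0 < rk len
  rk_eq_zero : ∀ j, len < j → rk j = 0
  gen_hom : ∀ i, (gen i).IsHomogeneous (twist 1 i)
  gen_min : ∀ i, constantCoeff (gen i) = 0
  gen_span : Ideal.span (Set.range gen) = I
  mat_hom : ∀ j i i', mat j i i' = 0 ∨
    ∃ d, (mat j i i').IsHomogeneous d ∧ d + twist (j + 1) i = twist (j + 2) i'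
  mat_min : ∀ j i i', constantCoeff (mat j i i') = 0
  exact_one : ∀ v : Fin (rk 1) → MvPolynomial (Fin N) K,
    (∑ i, v i * gen i = 0) ↔ v ∈ LinearMap.range (mat 0).mulVecLin
  exact_rest : ∀ j, LinearMap.ker (mat j).mulVecLin = LinearMap.range (mat (j + 1)).mulVecLin

/-- `a(Γ)`: the minimal twist `min_i {a_i}` occurring in the last module
`F_len = ⊕ R(-a_i)` of the minimal free resolution. -/
def MinFreeRes.aMin {N : ℕ} {K : Type} [Field K] {I : Ideal (MvPolynomial (Fin N) K)}
    (res : MinFreeRes N K I) : ℕ :=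
  Finset.univ.inf'
    (Finset.univ_nonempty_iff.mpr (Fin.pos_iff_nonempty.mp res.rk_len_pos))
    (fun i => res.twist res.len i)

/-- The minimum socle degree `A_n = min_i {a_i - n}` (here `n = len`, the length of
the resolution). -/
def MinFreeRes.A {N : ℕ} {K : Type} [Field K] {I : Ideal (MvPolynomial (Fin N) K)}
    (res : MinFreeRes N K I) : ℤ :=
  (res.aMin : ℤ) - res.len


/-- Embedding of points of `P^{m-1}` into the hyperplane `x_0 = 0` of `P^m`. -/
def embedPt {m : ℕ} (P : Projectivization K (Fin m → K)) :
    Projectivization K (Fin (m + 1) → K) :=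
  Projectivization.mk K (Fin.cons 0 P.rep) (by
    intro h
    apply P.rep_nonzero
    funext i
    simpa using congrFun h i.succ)

/-- The point `[1, c, 1, …, 1]` of `P^n` (a point on a line avoiding `x_0 = 0`). -/
def linePt (n : ℕ) (c : K) : Projectivization K (Fin (n + 1) → K) :=
  Projectivization.mk K (fun j => if (j : ℕ) = 1 then c else 1) (by
    intro h
    have h0 := congrFun h 0
    simp at h0)

open Classical in
/-- The set `Γ = Γ₁ ∪ Γ₂` of the Migliore construction: a set `Γ₀` of points of
`P^{n-1}` embedded into the hyperplane `x_0 = 0`, together with the points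
`[1, u_i, 1, …, 1]` on a line. -/
def MigGamma {n : ℕ} (Γ₀ : Finset (Projectivization K (Fin n → K)))
    {β : ℕ} (u : Fin β → K) : Finset (Projectivization K (Fin (n + 1) → K)) :=
  Γ₀.image embedPt ∪ Finset.univ.image (fun i => linePt n (u i))

/-- The ideal `I₁ = ⟨x_0, J⟩ ⊆ R = K[x_0, …, x_n]`, where
`J ⊆ S = K[x_1, …, x_n]` (vars of `S` indexed by `Fin n`, with `X i` of `S`
corresponding to `x_{i+1}` of `R`). -/
def I1 {n : ℕ} (J : Ideal (MvPolynomial (Fin n) K)) :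
    Ideal (MvPolynomial (Fin (n + 1)) K) :=
  Ideal.span {X 0} ⊔ Ideal.map (rename (Fin.succ : Fin n → Fin (n + 1))) J

/-- The polynomial `∏_{i=1}^β (u_i x_0 - x_1)`. -/
def prodPoly (n β : ℕ) (u : Fin β → K) : MvPolynomial (Fin (n + 1)) K :=
  ∏ i : Fin β, (C (u i) * X 0 - X 1)

/-- The ideal `I₂ = ⟨∏ (u_i x_0 - x_1), x_2 - x_0, …, x_n - x_0⟩` of the `β`
points `[1, u_i, 1, …, 1]` on a line. -/
def I2 (n β : ℕ) (u : Fin β → K) : Ideal (MvPolynomial (Fin (n + 1)) K) :=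
  Ideal.span ({prodPoly n β u} ∪
    {f | ∃ j : Fin (n + 1), 2 ≤ (j : ℕ) ∧ f = X j - X 0})

/-- The sequence `x_0, x_1^t, x_2, …, x_n`. -/
def ciList (K : Type) [Field K] (n t : ℕ) : List (MvPolynomial (Fin (n + 1)) K) :=
  X 0 :: X 1 ^ t :: ((List.finRange (n + 1)).drop 2).map X

/-- The complete intersection ideal `⟨x_0, x_1^t, x_2, …, x_n⟩`. -/
def CIdeal (K : Type) [Field K] (n t : ℕ) : Ideal (MvPolynomial (Fin (n + 1)) K) :=
  Ideal.span {f | f ∈ ciList K n t}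

/-- The set `𝒜 = {x_0(x_2 - x_0), …, x_0(x_n - x_0), x_0·∏(u_i x_0 - x_1)}`. -/
def calA (n β : ℕ) (u : Fin β → K) : Set (MvPolynomial (Fin (n + 1)) K) :=
  {f | ∃ j : Fin (n + 1), 2 ≤ (j : ℕ) ∧ f = X 0 * (X j - X 0)} ∪
    {X 0 * prodPoly n β u}


/-- An abstract exact complex with a regular sequence and a grading. -/
structure Cx (R : Type) [CommRing R] where
  F : ℕ → Type
  [grp : ∀ j, AddCommGroup (F j)]
  [mod : ∀ j, Module R (F j)]
  D : ∀ j, F (j + 1) →ₗ[R] F j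
  N : ℕ
  x : ℕ → R
  mm : Ideal R
  M : ℕ → ∀ j, Submodule R (F j)
  pr : ∀ j, ℕ → (F j →+ F j)
  x_mem : ∀ k, k ≤ N → x k ∈ mm
  M_zero : ∀ j z, z ∈ M 0 j → z = 0
  M_succ : ∀ k j z, z ∈ M (k + 1) j ↔ ∃ y, z - x k • y ∈ M k j
  reg : ∀ k j y, k ≤ N → x k • y ∈ M k j → y ∈ M k j
  D_M : ∀ k j z, z ∈ M k (j + 1) → D j z ∈ M k j
  exact : ∀ j z, D j z = 0 ↔ ∃ w, D (j + 1) w = z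
  nzd : ∀ y w, x 0 • y = D 0 w → ∃ w', y = D 0 w'
  pr_D : ∀ j e z, pr j e (D j z) = D j (pr (j + 1) e z)
  pr_x : ∀ j k e z, k ≤ N → pr j (e + 1) (x k • z) = x k • pr j e z
  pr_M : ∀ k j e z, z ∈ M k j → pr j e z ∈ M k j
  pr_pr : ∀ j e z, pr j e (pr j e z) = pr j e z

namespace Cx
variable {R : Type} [CommRing R] (C : Cx R)
instance (j : ℕ) : AddCommGroup (C.F j) := C.grp j
instance (j : ℕ) : Module R (C.F j) := C.mod j

/-- Boundary modulo `M k`. -/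
def Triv (k j : ℕ) (z : C.F j) : Prop := ∃ w, z - C.D j w ∈ C.M k j

/-- Cycle modulo `M k`. -/
def Cyc (k : ℕ) : (j : ℕ) → C.F j → Prop
  | 0, _ => True
  | j + 1, z => C.D j z ∈ C.M k j

lemma DD (j : ℕ) (z : C.F (j + 2)) : C.D j (C.D (j + 1) z) = 0 :=
  (C.exact j _).2 ⟨z, rfl⟩

lemma M_mono (k j : ℕ) (z : C.F j) (h : z ∈ C.M k j) : z ∈ C.M (k + 1) j :=
  (C.M_succ k j z).2 ⟨0, by simpa using h⟩

lemma x_M (k j : ℕ) (z : C.F j) : C.x k • z ∈ C.M (k + 1) j :=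
  (C.M_succ k j _).2 ⟨z, by simp⟩

lemma vanish (k : ℕ) (hk : k ≤ C.N) : ∀ (j : ℕ) (z : C.F (j + 1)), k ≤ j →
    C.D j z ∈ C.M (k + 1) j → C.Triv (k + 1) (j + 1) z := by
  induction k with
  | zero =>
    intro j z _ h
    obtain ⟨y, hy⟩ := (C.M_succ _ _ _).1 h
    have hy := sub_eq_zero.1 (C.M_zero _ _ hy)
    have key : ∃ t, y = C.D j t := by
      cases j with
      | zero => exact C.nzd y z hy.symm
      | succ j =>
        have h1 : C.x 0 • C.D j y = 0 := by rw [← map_smul, ← hy, C.DD]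
        have h2 := C.M_zero _ _ (C.reg 0 j (C.D j y) (by omega) (by rw [h1]; exact zero_mem _))
        obtain ⟨w, hw⟩ := (C.exact j y).1 h2
        exact ⟨w, hw.symm⟩
    obtain ⟨t, rfl⟩ := key
    have h3 : C.D j (z - C.x 0 • t) = 0 := by simp [hy]
    obtain ⟨w, hw⟩ := (C.exact j _).1 h3
    exact ⟨w, by rw [hw]; simpa using C.x_M 0 _ t⟩
  | succ k ih =>
    intro j z hj h
    obtain ⟨y, hy⟩ := (C.M_succ _ _ _).1 h
    obtain ⟨j, rfl⟩ : ∃ j', j = j' + 1 := ⟨j - 1, by omega⟩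
    have h1 : C.D j y ∈ C.M (k + 1) j := by
      apply C.reg _ _ _ hk
      have := C.D_M _ _ _ hy
      rw [map_sub, C.DD, map_smul] at this
      simpa using this
    obtain ⟨t, ht⟩ := ih (by omega) j y (by omega) h1
    have h2 : C.D (j + 1) (z - C.x (k + 1) • t) ∈ C.M (k + 1) (j + 1) := by
      have := add_mem hy (Submodule.smul_mem _ (C.x (k + 1)) ht)
      convert this using 1
      simp only [map_sub, map_smul, smul_sub]; abel
    obtain ⟨w, hw⟩ := ih (by omega) (j + 1) _ (by omega) h2
    refine ⟨w, (C.M_succ _ _ _).2 ⟨t, ?_⟩⟩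
    convert hw using 1
    abel

/-- A socle element at homological level `j`, of internal degree `e`. -/
def P (j e : ℕ) : Prop := ∃ z : C.F j, C.pr j e z = z ∧ C.Cyc (j + 1) j z ∧
  ¬ C.Triv (j + 1) j z ∧ ∀ a ∈ C.mm, C.Triv (j + 1) j (a • z)

lemma cyc_of_reg (j : ℕ) (hj : j + 1 ≤ C.N) (y : C.F j) (z : C.F (j + 1))
    (h : C.D j z - C.x (j + 1) • y ∈ C.M (j + 1) j) : C.Cyc (j + 1) j y := by
  cases j with
  | zero => trivial
  | succ j =>
    apply C.reg _ _ _ hj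
    have := C.D_M _ _ _ h
    rw [map_sub, C.DD, map_smul] at this
    simpa using this

lemma down (j e : ℕ) (hj : j + 1 ≤ C.N) (h : C.P (j + 1) (e + 1)) : C.P j e := by
  obtain ⟨z, hz, hc, hnt, hk⟩ := h
  obtain ⟨y0, hy0⟩ := (C.M_succ _ _ _).1 (show C.D j z ∈ C.M (j + 1 + 1) j from hc)
  have hy : C.D j z - C.x (j + 1) • C.pr j e y0 ∈ C.M (j + 1) j := by
    have := C.pr_M _ _ (e + 1) _ hy0
    rwa [map_sub, C.pr_D, hz, C.pr_x _ _ _ _ hj] at this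
  generalize hyy : C.pr j e y0 = y at hy
  refine ⟨y, by rw [← hyy, C.pr_pr], C.cyc_of_reg j hj y z hy, ?_, ?_⟩
  · rintro ⟨t, ht⟩
    apply hnt
    have h2 : C.D j (z - C.x (j + 1) • t) ∈ C.M (j + 1) j := by
      have := add_mem hy (Submodule.smul_mem _ (C.x (j + 1)) ht)
      convert this using 1
      simp only [map_sub, map_smul, smul_sub]; abel
    obtain ⟨w, hw⟩ := C.vanish j (by omega) j _ le_rfl h2
    refine ⟨w, (C.M_succ _ _ _).2 ⟨t, ?_⟩⟩
    convert hw using 1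
    abel
  · intro a ha
    obtain ⟨w, hw⟩ := hk a ha
    obtain ⟨t, ht⟩ := (C.M_succ _ _ _).1 hw
    refine ⟨t, C.reg _ _ _ hj ?_⟩
    have h1 := C.D_M _ _ _ ht
    have h2 := Submodule.smul_mem _ a hy
    have := sub_mem h1 h2
    convert this using 1
    simp only [map_sub, map_smul, smul_sub, C.DD, smul_comm a (C.x (j+1)) y]; abel

lemma up (j e : ℕ) (hj : j + 1 ≤ C.N) (h : C.P j e) : C.P (j + 1) (e + 1) := by
  obtain ⟨y, hz, hc, hnt, hk⟩ := h
  obtain ⟨z0, hz0⟩ := hk _ (C.x_mem (j + 1) hj)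
  have hy : C.x (j + 1) • y - C.D j (C.pr (j + 1) (e + 1) z0) ∈ C.M (j + 1) j := by
    have := C.pr_M _ _ (e + 1) _ hz0
    rwa [map_sub, C.pr_D, C.pr_x _ _ _ _ hj, hz] at this
  generalize hyy : C.pr (j + 1) (e + 1) z0 = z at hy
  refine ⟨z, by rw [← hyy, C.pr_pr], ?_, ?_, ?_⟩
  · refine (C.M_succ _ _ _).2 ⟨y, ?_⟩
    rw [← neg_sub]; exact neg_mem hy
  · rintro ⟨w, hw⟩
    obtain ⟨t, ht⟩ := (C.M_succ _ _ _).1 hw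
    refine hnt ⟨t, C.reg _ _ _ hj ?_⟩
    have := add_mem hy (C.D_M _ _ _ ht)
    convert this using 1
    simp only [map_sub, map_smul, smul_sub, C.DD]; abel
  · intro a ha
    obtain ⟨t, ht⟩ := hk a ha
    have h2 : C.D j (a • z - C.x (j + 1) • t) ∈ C.M (j + 1) j := by
      have := sub_mem (Submodule.smul_mem _ (C.x (j + 1)) ht) (Submodule.smul_mem _ a hy)
      convert this using 1
      simp only [map_sub, map_smul, smul_sub, smul_comm a (C.x (j+1)) y]; abel
    obtain ⟨w, hw⟩ := C.vanish j (by omega) j _ le_rfl h2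
    refine ⟨w, (C.M_succ _ _ _).2 ⟨t, ?_⟩⟩
    convert hw using 1
    abel

lemma chain (e : ℕ) : ∀ j, j ≤ C.N → (C.P j (e + j) ↔ C.P 0 e) := by
  intro j
  induction j with
  | zero => simp
  | succ j ih =>
    intro hj
    rw [← ih (by omega)]
    exact ⟨C.down j _ hj, C.up j _ hj⟩
end Cx

section comps
variable {σ : Type}

lemma hcomp_mul {p : MvPolynomial σ K} {d : ℕ} (hp : p.IsHomogeneous d) (k : ℕ)
    (f : MvPolynomial σ K) :
    homogeneousComponent (d + k) (p * f) = p * homogeneousComponent k f := by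
  classical
  have h1 : ∀ i, homogeneousComponent (d + k) (p * homogeneousComponent i f) =
      if i = k then p * homogeneousComponent i f else 0 := by
    intro i
    rw [homogeneousComponent_of_mem
      ((mem_homogeneousSubmodule _ _).2 (hp.mul (homogeneousComponent_isHomogeneous i f)))]
    simp [eq_comm]
  conv_lhs => rw [← sum_homogeneousComponent f, Finset.mul_sum, map_sum]
  rw [Finset.sum_congr rfl (fun i _ => h1 i), Finset.sum_ite_eq']
  split_ifs with h
  · rfl
  · rw [homogeneousComponent_eq_zero _ _ (by simpa using h), mul_zero]

lemma hcomp_mul_lt {p : MvPolynomial σ K} {d : ℕ} (hp : p.IsHomogeneous d) (k : ℕ) (hk : k < d)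
    (f : MvPolynomial σ K) :
    homogeneousComponent k (p * f) = 0 := by
  classical
  conv_lhs => rw [← sum_homogeneousComponent f, Finset.mul_sum, map_sum]
  refine Finset.sum_eq_zero fun i _ => ?_
  rw [homogeneousComponent_of_mem
      ((mem_homogeneousSubmodule _ _).2 (hp.mul (homogeneousComponent_isHomogeneous i f)))]
  rw [if_neg (by omega)]

/-- Component of degree `e` in `R(-t)`. -/
def hc (t e : ℕ) : MvPolynomial σ K →+ MvPolynomial σ K :=
  if t ≤ e then (homogeneousComponent (e - t)).toAddMonoidHom else 0

lemma hc_mul {p : MvPolynomial σ K} {d : ℕ} (hp : p.IsHomogeneous d) (t e : ℕ)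
    (f : MvPolynomial σ K) : hc t e (p * f) = p * hc (t + d) e f := by
  unfold hc
  by_cases h : t + d ≤ e
  · rw [if_pos h, if_pos (by omega)]
    have := hcomp_mul hp (e - (t + d)) f
    rw [show d + (e - (t + d)) = e - t by omega] at this
    exact this
  · rw [if_neg h]
    split_ifs with h2
    · have := hcomp_mul_lt hp (e - t) (by omega) f
      simpa using this
    · simp

lemma hc_succ (t e : ℕ) (f : MvPolynomial σ K) : hc (t + 1) (e + 1) f = hc t e f := by
  unfold hc; simp

lemma hc_hc (t e : ℕ) (f : MvPolynomial σ K) : hc t e (hc t e f) = hc t e f := by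
  unfold hc
  split_ifs
  · exact homogeneousComponent_eq_self (homogeneousComponent_mem _ _)
  · rfl

end comps

section seq
variable {n : ℕ} (c : Fin (n + 1) → K)

/-- The general linear form. -/
def ell : MvPolynomial (Fin (n + 1)) K := ∑ i, C (c i) * X i

/-- The sequence `ℓ, x_1, …, x_n`. -/
def xs (k : ℕ) : MvPolynomial (Fin (n + 1)) K :=
  if k = 0 then ell c else if h : k < n + 1 then X ⟨k, h⟩ else 0

/-- The ideals generated by initial parts of the sequence. -/
def ms : ℕ → Ideal (MvPolynomial (Fin (n + 1)) K)
  | 0 => ⊥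
  | k + 1 => ms k ⊔ Ideal.span {xs c k}

lemma ell_hom : (ell c).IsHomogeneous 1 :=
  IsHomogeneous.sum _ _ _ fun i _ => isHomogeneous_C_mul_X _ _

lemma xs_hom (k : ℕ) : (xs c k).IsHomogeneous 1 := by
  unfold xs
  split_ifs
  · exact ell_hom c
  · exact isHomogeneous_X _ _
  · exact isHomogeneous_zero _ _ _

lemma mem_ms_succ (k : ℕ) (f : MvPolynomial (Fin (n + 1)) K) :
    f ∈ ms c (k + 1) ↔ ∃ y, f - xs c k * y ∈ ms c k := by
  rw [ms, Submodule.mem_sup]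
  constructor
  · rintro ⟨a, ha, b, hb, rfl⟩
    obtain ⟨y, rfl⟩ := Ideal.mem_span_singleton'.1 hb
    exact ⟨y, by convert ha using 1; ring⟩
  · rintro ⟨y, hy⟩
    exact ⟨_, hy, xs c k * y, Ideal.mul_mem_right _ _ (Ideal.mem_span_singleton_self _), by ring⟩

lemma hc_ms (k t e : ℕ) : ∀ f ∈ ms c k, hc t e f ∈ ms c k := by
  induction k with
  | zero => intro f hf; rw [ms, Ideal.mem_bot] at hf; simp [hf]
  | succ k ih =>
    intro f hf
    obtain ⟨y, hy⟩ := (mem_ms_succ c k f).1 hf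
    refine (mem_ms_succ c k _).2 ⟨hc (t + 1) e y, ?_⟩
    rw [← hc_mul (xs_hom c k), ← map_sub]
    exact ih _ hy

lemma xs_mem (k l : ℕ) (h : k < l) : xs c k ∈ ms c l := by
  induction l with
  | zero => omega
  | succ l ih =>
    rw [ms]
    rcases Nat.lt_succ_iff_lt_or_eq.1 h with h | rfl
    · exact Ideal.mem_sup_left (ih h)
    · exact Ideal.mem_sup_right (Ideal.mem_span_singleton_self _)

lemma xs_pos (k : ℕ) (hk : k ≠ 0) (h : k < n + 1) : xs c k = X ⟨k, h⟩ := by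
  simp [xs, hk, h]

/-- Reduction modulo `ms c k`. -/
def redu (k : ℕ) : MvPolynomial (Fin (n + 1)) K →ₐ[K] MvPolynomial (Fin (n + 1)) K :=
  aeval fun i => if i = 0 then
      - C (c 0)⁻¹ * ∑ j : Fin (n + 1), (if (j : ℕ) < k then 0 else C (c j) * X j)
    else if (i : ℕ) < k then 0 else X i

lemma redu_X (k : ℕ) (i : Fin (n + 1)) (hi : i ≠ 0) :
    redu c k (X i) = if (i : ℕ) < k then 0 else X i := by
  simp [redu, hi]

lemma redu_zero (k : ℕ) : redu c k (X 0) =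
    - C (c 0)⁻¹ * ∑ j : Fin (n + 1), (if (j : ℕ) < k then 0 else C (c j) * X j) := by
  simp [redu]

variable (h0 : c 0 ≠ 0)
include h0

lemma redu_ell (k : ℕ) (hk : 0 < k) : redu c k (ell c) = 0 := by
  rw [ell, map_sum, Fin.sum_univ_succ, map_mul, redu_zero, Fin.sum_univ_succ]
  have : ∀ i : Fin n, redu c k (C (c i.succ) * X i.succ) =
      if ((i.succ : Fin (n+1)) : ℕ) < k then 0 else C (c i.succ) * X i.succ := by
    intro i
    rw [map_mul, redu_X _ _ _ (Fin.succ_ne_zero i)]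
    simp only [algHom_C, algebraMap_eq]
    split_ifs <;> simp
  rw [Finset.sum_congr rfl fun i _ => this i]
  simp only [algHom_C, algebraMap_eq, Fin.val_zero, hk, if_true, zero_add]
  rw [← mul_assoc, mul_neg, ← C_mul, mul_inv_cancel₀ h0]
  simp

lemma redu_ms (k : ℕ) (l : ℕ) (hl : l ≤ k) (hk : 0 < k) : ∀ f ∈ ms c l, redu c k f = 0 := by
  induction l with
  | zero => intro f hf; rw [ms, Ideal.mem_bot] at hf; simp [hf]
  | succ l ih =>
    intro f hf
    obtain ⟨y, hy⟩ := (mem_ms_succ c l f).1 hf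
    have h1 := ih (by omega) _ hy
    rw [map_sub, map_mul, sub_eq_zero] at h1
    rw [h1]
    have : redu c k (xs c l) = 0 := by
      unfold xs
      split_ifs with h2 h3
      · exact redu_ell c h0 k hk
      · rw [redu_X, if_pos]
        · simpa using hl
        · intro h; apply h2; simpa using congrArg Fin.val h
      · simp
    rw [this, zero_mul]

lemma sub_redu_mem (k : ℕ) (hk : 0 < k) (f : MvPolynomial (Fin (n + 1)) K) :
    f - redu c k f ∈ ms c k := by
  rw [← Ideal.Quotient.eq]
  have : (Ideal.Quotient.mkₐ K (ms c k)) =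
      (Ideal.Quotient.mkₐ K (ms c k)).comp (redu c k) := by
    apply MvPolynomial.algHom_ext
    intro i
    simp only [AlgHom.comp_apply, Ideal.Quotient.mkₐ_eq_mk]
    rw [Ideal.Quotient.eq]
    by_cases hi : i = 0
    · subst hi
      rw [redu_zero]
      have key : X 0 - - C (c 0)⁻¹ * ∑ j : Fin (n + 1),
            (if (j : ℕ) < k then 0 else C (c j) * X j) =
          C (c 0)⁻¹ * (ell c - ∑ j : Fin n,
            (if ((j.succ : Fin (n+1)) : ℕ) < k then C (c j.succ) * X j.succ else 0)) := by
        have e1 : (X 0 : MvPolynomial (Fin (n+1)) K) = C (c 0)⁻¹ * (C (c 0) * X 0) := by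
          rw [← mul_assoc, ← C_mul, inv_mul_cancel₀ h0]; simp
        rw [ell, Fin.sum_univ_succ, Fin.sum_univ_succ]
        conv_lhs => rw [e1]
        simp only [Fin.val_zero, hk, if_true, zero_add]
        have e2 : (∑ i : Fin n, C (c i.succ) * X i.succ : MvPolynomial (Fin (n+1)) K) =
          (∑ j : Fin n,
            (if ((j.succ : Fin (n+1)) : ℕ) < k then C (c j.succ) * X j.succ else 0)) +
          (∑ j : Fin n,
            (if ((j.succ : Fin (n+1)) : ℕ) < k then 0 else C (c j.succ) * X j.succ)) := by
          rw [← Finset.sum_add_distrib]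
          refine Finset.sum_congr rfl fun i _ => ?_
          split_ifs <;> simp
        rw [e2]; ring
      rw [key]
      refine Ideal.mul_mem_left _ _ (sub_mem ?_ (sum_mem fun j _ => ?_))
      · simpa [xs] using xs_mem c 0 k hk
      · split_ifs with h
        · refine Ideal.mul_mem_left _ _ ?_
          have := xs_mem c _ k h
          rwa [xs_pos c _ (by simp) j.succ.2] at this
        · exact zero_mem _
    · rw [redu_X _ _ _ hi]
      split_ifs with h
      · have := xs_mem c _ k h
        rw [xs_pos c _ (by intro h; apply hi; ext; simpa using h) i.2] at this
        simpa using this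
      · simp
  exact congrArg (fun φ => φ f) this

lemma ms_reg (k : ℕ) (hk : k ≤ n) (f : MvPolynomial (Fin (n + 1)) K)
    (h : xs c k * f ∈ ms c k) : f ∈ ms c k := by
  rcases Nat.eq_zero_or_pos k with rfl | hk0
  · rw [ms, Ideal.mem_bot] at h ⊢
    rcases mul_eq_zero.1 h with h | h
    · exfalso
      apply h0
      have : eval (Pi.single 0 1) (ell c) = c 0 := by
        simp [ell, Pi.single_apply]
      rw [show xs c 0 = ell c from by simp [xs]] at h
      rw [h] at this
      simpa using this.symm
    · exact h
  · have h1 := redu_ms c h0 k k le_rfl hk0 _ h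
    rw [xs_pos c k (by omega) (by omega), map_mul, redu_X, if_neg (by simp)] at h1
    · rcases mul_eq_zero.1 h1 with h2 | h2
      · exact absurd h2 (X_ne_zero _)
      · have := sub_redu_mem c h0 k hk0 f
        rwa [h2, sub_zero] at this
    · intro h; have := congrArg Fin.val h; simp at this; omega

lemma ms_top (f : MvPolynomial (Fin (n + 1)) K) :
    f ∈ ms c (n + 1) ↔ constantCoeff f = 0 := by
  have hX : redu c (n + 1) = (Algebra.ofId K _).comp
      (aeval (fun _ => (0 : K)) : MvPolynomial (Fin (n+1)) K →ₐ[K] K) := by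
    apply MvPolynomial.algHom_ext
    intro i
    by_cases hi : i = 0
    · subst hi
      rw [redu_zero]
      rw [Finset.sum_eq_zero]
      · simp
      · intro j _; rw [if_pos j.2]
    · rw [redu_X _ _ _ hi, if_pos i.2]; simp
  have h2 : redu c (n + 1) f = C (constantCoeff f) := by
    rw [hX]
    simp [Algebra.ofId_apply, aeval_def, constantCoeff_eq, algebraMap_eq, eval₂_zero_apply]
  constructor
  · intro h
    have := redu_ms c h0 (n+1) (n+1) le_rfl (by omega) f h
    rw [h2] at this
    exact C_eq_zero.1 this
  · intro h
    have := sub_redu_mem c h0 (n+1) (by omega) f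
    rwa [h2, h, map_zero, sub_zero] at this

end seq

section resol
variable {n : ℕ} {I : Ideal (MvPolynomial (Fin (n + 1)) K)} (res : MinFreeRes (n + 1) K I)

/-- Ranks, including `F_0 = R`. -/
def rr : ℕ → ℕ
  | 0 => 1
  | j + 1 => res.rk (j + 1)

/-- Twists, including `F_0 = R`. -/
def tt : (j : ℕ) → Fin (rr res j) → ℕ
  | 0 => fun _ => 0
  | j + 1 => res.twist (j + 1)

/-- Matrices, including `F_1 → F_0`. -/
def DM : (j : ℕ) → Matrix (Fin (rr res j)) (Fin (rr res (j + 1))) (MvPolynomial (Fin (n + 1)) K)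
  | 0 => fun _ i => res.gen i
  | j + 1 => res.mat j

lemma DM_hom : ∀ j i i', DM res j i i' = 0 ∨
    ∃ d, (DM res j i i').IsHomogeneous d ∧ d + tt res j i = tt res (j + 1) i'
  | 0, _, i' => Or.inr ⟨_, res.gen_hom i', rfl⟩
  | j + 1, i, i' => res.mat_hom j i i'

lemma DM_min : ∀ j i i', constantCoeff (DM res j i i') = 0
  | 0, _, i' => res.gen_min i'
  | j + 1, i, i' => res.mat_min j i i'

lemma D0_apply (z : Fin (res.rk 1) → MvPolynomial (Fin (n + 1)) K) (i : Fin 1) :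
    (show Fin 1 → MvPolynomial (Fin (n + 1)) K from (DM res 0).mulVecLin z) i =
      ∑ i, z i * res.gen i := by
  have h : (show Fin 1 → MvPolynomial (Fin (n + 1)) K from (DM res 0).mulVecLin z) i =
      ∑ i, res.gen i * z i := rfl
  rw [h]
  exact Finset.sum_congr rfl fun i _ => mul_comm (res.gen i) (z i)

lemma DM_exact : ∀ j z, (DM res j).mulVecLin z = 0 ↔ ∃ w, (DM res (j + 1)).mulVecLin w = z
  | 0, z => by
    refine Iff.trans ?_ (res.exact_one z)
    constructor
    · intro h
      exact (D0_apply res z 0).symm.trans (congrFun h (0 : Fin 1))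
    · intro h
      funext i
      exact (D0_apply res z i).trans h
  | j + 1, z => by
    have h := res.exact_rest j
    have h2 : z ∈ LinearMap.ker (res.mat j).mulVecLin ↔
      z ∈ LinearMap.range (res.mat (j + 1)).mulVecLin := by rw [h]
    exact h2

lemma range_D0 (y : Fin (rr res 0) → MvPolynomial (Fin (n + 1)) K) :
    (∃ w, y = (DM res 0).mulVecLin w) ↔ y (0 : Fin 1) ∈ I := by
  refine Iff.trans ?_ (iff_of_eq (congrArg (fun J => y (0 : Fin 1) ∈ J) res.gen_span))
  constructor
  · rintro ⟨w, rfl⟩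
    have := D0_apply res w 0
    change (show Fin 1 → MvPolynomial (Fin (n + 1)) K from (DM res 0).mulVecLin w) 0 ∈ _
    rw [this]
    exact sum_mem fun i _ => Ideal.mul_mem_left _ _ (Ideal.subset_span ⟨i, rfl⟩)
  · intro h
    obtain ⟨w, hw⟩ := (Ideal.mem_span_range_iff_exists_fun).1 h
    refine ⟨w, ?_⟩
    funext i
    have : i = (0 : Fin 1) := Subsingleton.elim (α := Fin 1) _ _
    rw [this]
    exact hw.symm.trans (D0_apply res w 0).symm

/-- The abstract complex attached to a resolution. -/
def resCx (c : Fin (n + 1) → K) (h0 : c 0 ≠ 0) (hI : ∀ f, ell c * f ∈ I → f ∈ I) :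
    Cx (MvPolynomial (Fin (n + 1)) K) where
  F j := Fin (rr res j) → MvPolynomial (Fin (n + 1)) K
  D j := (DM res j).mulVecLin
  N := n
  x := xs c
  mm := ms c (n + 1)
  M k j := Submodule.pi Set.univ (fun _ => ms c k)
  pr j e :=
    { toFun := fun z i => hc (tt res j i) e (z i)
      map_zero' := by funext i; simp
      map_add' := by intro a b; funext i; simp }
  x_mem k hk := xs_mem c k _ (by omega)
  M_zero j z hz := by
    funext i
    have := hz i trivial
    simpa [ms] using this
  M_succ k j z := by
    constructor
    · intro h
      have := fun i => (mem_ms_succ c k (z i)).1 (h i trivial)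
      choose y hy using this
      exact ⟨y, fun i _ => hy i⟩
    · rintro ⟨y, hy⟩ i _
      exact (mem_ms_succ c k (z i)).2 ⟨y i, hy i trivial⟩
  reg k j y hk h := fun i _ => ms_reg c h0 k hk (y i) (h i trivial)
  D_M k j z hz := by
    intro i _
    simp only [Matrix.mulVecLin_apply, Matrix.mulVec, dotProduct]
    exact sum_mem fun i' _ => Ideal.mul_mem_left _ _ (hz i' trivial)
  exact j z := DM_exact res j z
  nzd y w h := by
    rw [range_D0]
    apply hI
    have h1 := (range_D0 res _).1 ⟨w, h⟩
    have h2 : xs c 0 = ell c := by simp [xs]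
    rw [h2] at h1
    exact h1
  pr_D j e z := by
    funext i
    simp only [Matrix.mulVecLin_apply, Matrix.mulVec, dotProduct, AddMonoidHom.coe_mk,
      ZeroHom.coe_mk, map_sum]
    refine Finset.sum_congr rfl fun i' _ => ?_
    rcases DM_hom res j i i' with h | ⟨d, hd, hdt⟩
    · simp [h]
    · rw [hc_mul hd, ← hdt, add_comm d]
  pr_x j k e z _ := by
    funext i
    simp only [AddMonoidHom.coe_mk, ZeroHom.coe_mk, Pi.smul_apply, smul_eq_mul]
    rw [hc_mul (xs_hom c k), hc_succ]
  pr_M k j e z hz := fun i _ => hc_ms c k _ _ _ (hz i trivial)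
  pr_pr j e z := by
    funext i
    exact hc_hc _ _ _

lemma col_ne (j : ℕ) (i' : Fin (rr res (j + 1))) : ∃ i, DM res j i i' ≠ 0 := by
  classical
  by_contra h
  push Not at h
  have h1 : (DM res j).mulVecLin (Pi.single i' 1) = 0 := by
    funext i
    simp [h i]
  obtain ⟨w, hw⟩ := (DM_exact res j _).1 h1
  have h2 := congrArg constantCoeff (congrFun hw i')
  simp only [Matrix.mulVecLin_apply, Matrix.mulVec, dotProduct, map_sum, map_mul,
    DM_min, zero_mul, Finset.sum_const_zero] at h2
  simp at h2

lemma le_tt : ∀ j i, j ≤ tt res j i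
  | 0, _ => Nat.zero_le _
  | j + 1, i' => by
    obtain ⟨i, hi⟩ := col_ne res j i'
    rcases DM_hom res j i i' with h | ⟨d, hd, hdt⟩
    · exact absurd h hi
    · have h1 := le_tt j i
      have : d ≠ 0 := by
        rintro rfl
        apply hi
        have := DM_min res j i i'
        rw [← homogeneousComponent_eq_self ((mem_homogeneousSubmodule _ _).2 hd),
          homogeneousComponent_zero]
        rw [← constantCoeff_eq, this, map_zero]
      omega

theorem res_socle (hn : 1 ≤ n) (hlen : res.len = n) (c : Fin (n + 1) → K) (h0 : c 0 ≠ 0)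
    (hI : ∀ f, ell c * f ∈ I → f ∈ I) (e : ℕ) :
    (∃ i, res.twist n i = e + n) ↔ ∃ g : MvPolynomial (Fin (n + 1)) K, g.IsHomogeneous e ∧
      g ∉ I ⊔ Ideal.span {ell c} ∧ ∀ k, X k * g ∈ I ⊔ Ideal.span {ell c} := by
  classical
  have htriv : ∀ y, (resCx res c h0 hI).Triv 1 0 y ↔ 
      (show Fin 1 → MvPolynomial (Fin (n + 1)) K from y) 0 ∈ I ⊔ Ideal.span {ell c} := by
    intro y
    rw [Submodule.mem_sup]
    constructor
    · rintro ⟨w, hw⟩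
      have h1 := (mem_ms_succ c 0 _).1 (hw (0 : Fin 1) trivial)
      obtain ⟨t, ht⟩ := h1
      rw [ms, Ideal.mem_bot, sub_eq_zero] at ht
      refine ⟨_, (range_D0 res _).1 ⟨w, rfl⟩, ell c * t,
        Ideal.mul_mem_right _ _ (Ideal.mem_span_singleton_self _), ?_⟩
      have h2 : xs c 0 = ell c := by simp [xs]
      rw [← h2, ← ht]
      exact add_sub_cancel _ _
    · rintro ⟨a, ha, b, hb, hab⟩
      obtain ⟨w, hw⟩ := (range_D0 res (fun _ => a)).2 ha
      refine ⟨w, fun i _ => ?_⟩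
      obtain ⟨t, rfl⟩ := Ideal.mem_span_singleton'.1 hb
      refine (mem_ms_succ c 0 _).2 ⟨t, ?_⟩
      have h2 : xs c 0 = ell c := by simp [xs]
      have h3 : i = (0 : Fin 1) := Subsingleton.elim (α := Fin 1) _ _
      rw [ms, Ideal.mem_bot, h2, h3, sub_eq_zero]
      have h4 := congrFun hw (0 : Fin 1)
      change (show Fin 1 → MvPolynomial (Fin (n + 1)) K from y) 0 -
        (DM res 0).mulVecLin w (0 : Fin 1) = _
      rw [← h4, ← hab]; ring
  have hP0 : (resCx res c h0 hI).P 0 e ↔ ∃ g : MvPolynomial (Fin (n + 1)) K, g.IsHomogeneous e ∧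
      g ∉ I ⊔ Ideal.span {ell c} ∧ ∀ k, X k * g ∈ I ⊔ Ideal.span {ell c} := by
    constructor
    · rintro ⟨z, hz, -, hnt, hk⟩
      refine ⟨(show Fin 1 → MvPolynomial (Fin (n + 1)) K from z) 0, ?_, ?_, ?_⟩
      · have := congrFun hz (0 : Fin 1)
        rw [← this]
        change (hc 0 e _).IsHomogeneous e
        simp only [hc, Nat.zero_le, if_true, Nat.sub_zero]
        exact homogeneousComponent_isHomogeneous _ _
      · exact fun h => hnt ((htriv _).2 h)
      · intro k
        exact (htriv _).1 (hk (X k) ((ms_top c h0 _).2 (by simp)))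
    · rintro ⟨g, hg, hgn, hgk⟩
      refine ⟨fun _ => g, ?_, trivial, ?_, ?_⟩
      · funext i
        have h3 : i = (0 : Fin 1) := Subsingleton.elim (α := Fin 1) _ _
        rw [h3]
        change hc 0 e g = g
        simp only [hc, Nat.zero_le, if_true, Nat.sub_zero]
        exact homogeneousComponent_eq_self ((mem_homogeneousSubmodule _ _).2 hg)
      · exact fun h => hgn ((htriv _).1 h)
      · intro a ha
        refine (htriv _).2 ?_
        change a * g ∈ _
        have ha := (ms_top c h0 a).1 ha
        have h5 : a ∈ idealOfVars (Fin (n + 1)) K := by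
          rw [← pow_one (idealOfVars (Fin (n + 1)) K), mem_pow_idealOfVars_iff']
          intro x hx
          have : x = 0 := by
            rw [← Finsupp.degree_eq_zero_iff]; omega
          rw [this, ← constantCoeff_eq, ha]
        refine Submodule.span_induction (p := fun a _ => a * g ∈ I ⊔ Ideal.span {ell c})
          ?_ ?_ ?_ ?_ h5
        · rintro _ ⟨k, rfl⟩; exact hgk k
        · simp
        · intro a b _ _ ha hb; rw [add_mul]; exact add_mem ha hb
        · intro a b _ hb; rw [smul_eq_mul, mul_assoc]; exact Ideal.mul_mem_left _ _ hb
  rw [← hP0, ← (resCx res c h0 hI).chain e n (le_refl n)]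
  obtain ⟨m, rfl⟩ : ∃ m, n = m + 1 := ⟨n - 1, by omega⟩
  have hempty : IsEmpty (Fin (rr res (m + 1 + 1))) := by
    have : rr res (m + 1 + 1) = 0 := res.rk_eq_zero _ (by omega)
    rw [this]; infer_instance
  have hDz : ∀ w, (DM res (m + 1)).mulVecLin w = 0 := by
    intro w
    have : w = 0 := Subsingleton.elim _ _
    rw [this, map_zero]
  constructor
  · rintro ⟨i, hi⟩
    refine ⟨(Pi.single i 1 : Fin (rr res (m + 1)) → MvPolynomial (Fin (m + 1 + 1)) K), ?_, ?_, ?_, ?_⟩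
    · funext i'
      change hc (tt res (m + 1) i') _ _ = _
      by_cases h : i' = i
      · subst h
        rw [Pi.single_eq_same, show tt res (m + 1) i' = e + (m + 1) from hi]
        simp [hc, homogeneousComponent_zero]
      · rw [Pi.single_eq_of_ne h, map_zero]
    · intro i' _
      refine (ms_top c h0 _).2 ?_
      change constantCoeff ((DM res m).mulVecLin _ i') = 0
      simp only [Matrix.mulVecLin_apply, Matrix.mulVec, dotProduct, map_sum, map_mul,
        DM_min, zero_mul, Finset.sum_const_zero]
    · rintro ⟨w, hw⟩
      have h1 := (ms_top c h0 _).1 (hw i trivial)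
      have h2 : (DM res (m + 1)).mulVecLin w i = 0 := congrFun (hDz w) i
      have h3 : constantCoeff ((Pi.single i 1 :
        Fin (res.rk (m + 1)) → MvPolynomial (Fin (m + 1 + 1)) K) i) = 0 := by
        have h4 := congrArg constantCoeff h2
        have h5 := h1
        change constantCoeff ((Pi.single i 1 :
          Fin (res.rk (m + 1)) → MvPolynomial (Fin (m + 1 + 1)) K) i -
          (DM res (m + 1)).mulVecLin w i) = 0 at h5
        rw [map_sub] at h5
        rw [map_zero] at h4
        exact (sub_eq_zero.1 h5).trans h4
      simp at h3
    · intro a ha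
      refine ⟨0, fun i' _ => ?_⟩
      rw [map_zero, sub_zero]
      exact Ideal.mul_mem_right _ _ ha
  · rintro ⟨z, hz, -, hnt, -⟩
    by_contra hcon
    push Not at hcon
    apply hnt
    refine ⟨0, fun i _ => ?_⟩
    rw [map_zero, sub_zero]
    refine (ms_top c h0 _).2 ?_
    rw [← congrFun hz i]
    change constantCoeff (hc (tt res (m + 1) i) (e + (m + 1)) _) = 0
    have h2 : tt res (m + 1) i ≠ e + (m + 1) := hcon i
    unfold hc
    split_ifs with h
    · change constantCoeff (homogeneousComponent _ _) = 0
      rw [constantCoeff_eq, coeff_homogeneousComponent, if_neg]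
      simp; omega
    · simp

end resol

section geom

lemma hom_eval_smul {m d : ℕ} {f : MvPolynomial (Fin m) K} (hf : f.IsHomogeneous d) (a : K)
    (v : Fin m → K) : eval (a • v) f = a ^ d * eval v f := by
  rw [eval_eq', eval_eq', Finset.mul_sum]
  refine Finset.sum_congr rfl fun x hx => ?_
  have h1 : x.degree = d := (hf.degree_eq_sum_deg_support hx).symm
  simp only [Pi.smul_apply, smul_eq_mul, mul_pow, Finset.prod_mul_distrib,
    Finset.prod_pow_eq_pow_sum]
  rw [← Finsupp.degree_eq_sum, h1]
  ring

lemma vanish_hom [Infinite K] {m : ℕ} (Γ : Set (Projectivization K (Fin m → K)))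
    (f : MvPolynomial (Fin m) K) (hf : f ∈ vanishingIdeal Γ) (d : ℕ) :
    homogeneousComponent d f ∈ vanishingIdeal Γ := by
  intro P hP v hv hvP
  let p : Polynomial K := ∑ i ∈ Finset.range (f.totalDegree + 1),
    Polynomial.C (eval v (homogeneousComponent i f)) * Polynomial.X ^ i
  have h1 : ∀ a : K, a ≠ 0 → p.eval a = 0 := by
    intro a ha
    have h2 : eval (a • v) f = 0 := by
      refine hf P hP (a • v) (smul_ne_zero ha hv) ?_
      rw [← hvP, Projectivization.mk_eq_mk_iff']
      exact ⟨a, rfl⟩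
    rw [← sum_homogeneousComponent f, map_sum] at h2
    rw [← h2, Polynomial.eval_finset_sum]
    refine Finset.sum_congr rfl fun i _ => ?_
    rw [hom_eval_smul (homogeneousComponent_isHomogeneous i f)]
    rw [Polynomial.eval_mul, Polynomial.eval_C, Polynomial.eval_pow, Polynomial.eval_X, mul_comm]
  have h3 : Polynomial.X * p = 0 := by
    apply Polynomial.funext
    intro a
    by_cases ha : a = 0
    · simp [ha]
    · simp [h1 a ha]
  have h4 : p = 0 := by
    rcases mul_eq_zero.1 h3 with h | h
    · exact absurd h Polynomial.X_ne_zero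
    · exact h
  by_cases hd : d < f.totalDegree + 1
  · have h5 : p.coeff d = eval v (homogeneousComponent d f) := by
      simp only [p, Polynomial.finset_sum_coeff, Polynomial.coeff_C_mul_X_pow]
      rw [Finset.sum_ite_eq, if_pos (Finset.mem_range.2 hd)]
    rw [← h5, h4, Polynomial.coeff_zero]
  · rw [homogeneousComponent_eq_zero _ _ (by omega), map_zero]

lemma finrank_hom (m d : ℕ) : Module.finrank K (homogeneousSubmodule (Fin (m + 1)) K d) =
    (d + m).choose m := by
  classical
  have e1 : {x : Fin (m + 1) →₀ ℕ | x.degree = d} =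
      ((Finset.univ : Finset (Fin (m + 1))).finsuppAntidiag d : Set _) := by
    ext x
    simp [Finset.mem_finsuppAntidiag, Finsupp.degree_eq_sum]
  rw [homogeneousSubmodule_eq_finsupp_supported, e1,
    (AddMonoidAlgebra.supportedEquivFinsupp _).finrank_eq, Module.finrank_finsupp_self]
  simp only [Finset.coe_sort_coe, Fintype.card_coe]
  rw [Finset.card_finsuppAntidiag_nat_eq_choose, Finset.card_univ, Fintype.card_fin,
    show m + 1 + d - 1 = d + m by omega]
  rw [← Nat.choose_symm_add, add_comm]

lemma degPart_zero {m d α : ℕ} (J : Ideal (MvPolynomial (Fin (m + 1)) K))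
    (h : HF J d = min ((d + (m + 1) - 1).choose (m + 1 - 1)) α)
    (hα : (d + (m + 1) - 1).choose (m + 1 - 1) ≤ α) (f : MvPolynomial (Fin (m + 1)) K)
    (hf : f ∈ J) (hd : f.IsHomogeneous d) : f = 0 := by
  rw [min_eq_left hα, HF, finrank_hom] at h
  have hpos : 0 < (d + m).choose m := Nat.choose_pos (by omega)
  have h1 : hdim J d = 0 := by
    simp only [show d + (m + 1) - 1 = d + m by omega, Nat.add_sub_cancel] at h
    omega
  have : Module.Finite K (homogeneousSubmodule (Fin (m + 1)) K d) :=
    Module.Finite.iff_fg.2 (homogeneousSubmodule_fg _ _ _)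
  have : Module.Finite K (degPart J d) := by
    have hle : degPart J d ≤ homogeneousSubmodule (Fin (m + 1)) K d := inf_le_right
    exact Submodule.finiteDimensional_of_le hle
  have h2 : degPart J d = ⊥ := Submodule.finrank_eq_zero.1 h1
  have h3 : f ∈ degPart J d := ⟨hf, hd⟩
  rw [h2] at h3
  simpa using h3

open Classical in
lemma mem_emb {m : ℕ} (Γ₀ : Finset (Projectivization K (Fin m → K)))
    (f : MvPolynomial (Fin (m + 1)) K) :
    f ∈ vanishingIdeal (Γ₀.image embedPt : Finset _) ↔
    ∀ (w : Fin m → K) (hw : w ≠ 0), Projectivization.mk K w hw ∈ Γ₀ →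
      eval (Fin.cons 0 w : Fin (m + 1) → K) f = 0 := by
  have hcons : ∀ (a : K) (w : Fin m → K), a • (Fin.cons 0 w : Fin (m + 1) → K) =
      Fin.cons 0 (a • w) := by
    intro a w
    funext i
    refine Fin.cases ?_ (fun i => ?_) i <;> simp
  constructor
  · intro h w hw hmem
    refine h (embedPt (Projectivization.mk K w hw)) ?_ _ ?_ ?_
    · exact Finset.mem_coe.2 (Finset.mem_image_of_mem _ hmem)
    · intro h0
      apply hw
      funext i
      simpa using congrFun h0 i.succ
    · obtain ⟨a, ha⟩ := (Projectivization.mk_eq_mk_iff' K w _ hw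
        (Projectivization.rep_nonzero (Projectivization.mk K w hw))).1
        (by rw [Projectivization.mk_rep])
      rw [embedPt, Projectivization.mk_eq_mk_iff']
      exact ⟨a, by rw [hcons, ha]⟩
  · intro h P hP v hv hvP
    obtain ⟨Q, hQ, rfl⟩ := Finset.mem_image.1 (Finset.mem_coe.1 hP)
    rw [embedPt, Projectivization.mk_eq_mk_iff'] at hvP
    obtain ⟨a, rfl⟩ := hvP
    have ha : a ≠ 0 := by rintro rfl; simp at hv
    rw [hcons]
    refine h _ (smul_ne_zero ha Q.rep_nonzero) ?_
    have : Projectivization.mk K (a • Q.rep) (smul_ne_zero ha Q.rep_nonzero) = Q := by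
      conv_rhs => rw [← Q.mk_rep]
      rw [Projectivization.mk_eq_mk_iff']
      exact ⟨a, rfl⟩
    rwa [this]

/-- The vector `(1, c, 1, …, 1)`. -/
def lv (n : ℕ) (c : K) : Fin (n + 1) → K := fun j => if (j : ℕ) = 1 then c else 1

open Classical in
lemma mem_line {n β : ℕ} (u : Fin β → K) (f : MvPolynomial (Fin (n + 1)) K) :
    f ∈ vanishingIdeal (Finset.univ.image (fun i => linePt n (u i)) : Finset _) ↔
    ∀ (i : Fin β) (a : K), a ≠ 0 → eval (a • lv n (u i)) f = 0 := by
  have hl : ∀ c : K, lv n c ≠ 0 := by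
    intro c h
    have := congrFun h 0
    simp [lv] at this
  constructor
  · intro h i a ha
    refine h (linePt n (u i)) ?_ _ (smul_ne_zero ha (hl _)) ?_
    · exact Finset.mem_coe.2 (Finset.mem_image_of_mem _ (Finset.mem_univ i))
    · rw [linePt, Projectivization.mk_eq_mk_iff']
      exact ⟨a, rfl⟩
  · intro h P hP v hv hvP
    obtain ⟨i, _, rfl⟩ := Finset.mem_image.1 (Finset.mem_coe.1 hP)
    rw [linePt, Projectivization.mk_eq_mk_iff'] at hvP
    obtain ⟨a, rfl⟩ := hvP
    have ha : a ≠ 0 := by rintro rfl; simp at hv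
    exact h i a ha

open Classical in
lemma mem_mig {n β : ℕ} (Γ₀ : Finset (Projectivization K (Fin n → K))) (u : Fin β → K)
    (f : MvPolynomial (Fin (n + 1)) K) :
    f ∈ vanishingIdeal (MigGamma Γ₀ u : Set (Projectivization K (Fin (n + 1) → K))) ↔
    f ∈ vanishingIdeal (Γ₀.image embedPt : Finset _) ∧
    f ∈ vanishingIdeal (Finset.univ.image (fun i => linePt n (u i)) : Finset _) := by
  constructor
  · intro h
    exact ⟨fun P hP => h P (Finset.mem_coe.2 (Finset.mem_union_left _ hP)),
      fun P hP => h P (Finset.mem_coe.2 (Finset.mem_union_right _ hP))⟩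
  · rintro ⟨h1, h2⟩ P hP
    rcases Finset.mem_union.1 (Finset.mem_coe.1 hP) with h | h
    · exact h1 P h
    · exact h2 P h

/-- Setting `x_0 = 0`. -/
def psi1 (n : ℕ) : MvPolynomial (Fin (n + 1)) K →ₐ[K] MvPolynomial (Fin (n + 1)) K :=
  aeval fun i => if i = 0 then 0 else X i

/-- Setting `x_j = x_0` for `j ≥ 2`. -/
def psi2 (n : ℕ) : MvPolynomial (Fin (n + 1)) K →ₐ[K] MvPolynomial (Fin (n + 1)) K :=
  aeval fun i => if 2 ≤ (i : ℕ) then X 0 else X i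

lemma eval_psi1 {n : ℕ} (w : Fin n → K) (f : MvPolynomial (Fin (n + 1)) K) :
    eval (Fin.cons 0 w : Fin (n + 1) → K) (psi1 n f) = eval (Fin.cons 0 w : Fin (n + 1) → K) f := by
  have : (aeval (Fin.cons 0 w : Fin (n + 1) → K) : MvPolynomial (Fin (n + 1)) K →ₐ[K] K).comp
      (psi1 n) = aeval (Fin.cons 0 w : Fin (n + 1) → K) := by
    apply MvPolynomial.algHom_ext
    intro i
    refine Fin.cases ?_ (fun i => ?_) i <;> simp [psi1]
  have := congrArg (fun φ => φ f) this
  simpa [coe_aeval_eq_eval] using this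

lemma eval_psi2 {n : ℕ} (v : Fin (n + 1) → K) (f : MvPolynomial (Fin (n + 1)) K) :
    eval v (psi2 n f) = eval (fun i : Fin (n + 1) => if 2 ≤ (i : ℕ) then v 0 else v i) f := by
  have : (aeval v : MvPolynomial (Fin (n + 1)) K →ₐ[K] K).comp
      (psi2 n) = aeval (fun i : Fin (n + 1) => if 2 ≤ (i : ℕ) then v 0 else v i) := by
    apply MvPolynomial.algHom_ext
    intro i
    simp only [AlgHom.comp_apply, psi2, aeval_X]
    split_ifs <;> simp
  have := congrArg (fun φ => φ f) this
  simpa [coe_aeval_eq_eval] using this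

open Classical in
lemma mem_emb_of_psi1 {n : ℕ} (Γ₀ : Finset (Projectivization K (Fin n → K)))
    (f : MvPolynomial (Fin (n + 1)) K) (h : psi1 n f = 0) :
    f ∈ vanishingIdeal (Γ₀.image embedPt : Finset _) := by
  rw [mem_emb]
  intro w _ _
  rw [← eval_psi1, h, map_zero]

open Classical in
lemma mem_line_of_psi2 {n β : ℕ} (u : Fin β → K)
    (f : MvPolynomial (Fin (n + 1)) K) (h : psi2 n f = 0) :
    f ∈ vanishingIdeal (Finset.univ.image (fun i => linePt n (u i)) : Finset _) := by
  rw [mem_line]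
  intro i a _
  have h1 := eval_psi2 (a • lv n (u i)) f
  rw [h, map_zero] at h1
  rw [h1]
  refine congrArg (fun v => eval v f) ?_
  funext j
  split_ifs with hj
  · have : (j : ℕ) ≠ 1 := by omega
    simp [lv, this]
  · rfl

open Classical in
lemma psi1_of_mem {m d α : ℕ} (Γ₀ : Finset (Projectivization K (Fin (m + 1) → K)))
    (h : HF (vanishingIdeal (Γ₀ : Set (Projectivization K (Fin (m + 1) → K)))) d =
      min ((d + (m + 1) - 1).choose (m + 1 - 1)) α)
    (hα : (d + (m + 1) - 1).choose (m + 1 - 1) ≤ α) (f : MvPolynomial (Fin (m + 1 + 1)) K)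
    (hf : f ∈ vanishingIdeal (Γ₀.image embedPt : Finset _)) (hd : f.IsHomogeneous d) :
    psi1 (m + 1) f = 0 := by
  let q : MvPolynomial (Fin (m + 1 + 1)) K →ₐ[K] MvPolynomial (Fin (m + 1)) K :=
    aeval (Fin.cons 0 (fun i => X i))
  have hq : psi1 (m + 1) = (rename Fin.succ).comp q := by
    apply MvPolynomial.algHom_ext
    intro i
    refine Fin.cases ?_ (fun i => ?_) i <;> simp [psi1, q]
  have hqe : ∀ (w : Fin (m + 1) → K) (g), eval w (q g) = eval (Fin.cons 0 w : Fin (m + 1 + 1) → K) g := by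
    intro w g
    have : (aeval w : MvPolynomial (Fin (m + 1)) K →ₐ[K] K).comp
        q = aeval (Fin.cons 0 w : Fin (m + 1 + 1) → K) := by
      apply MvPolynomial.algHom_ext
      intro i
      refine Fin.cases ?_ (fun i => ?_) i <;> simp [q]
    have := congrArg (fun φ => φ g) this
    simpa [coe_aeval_eq_eval] using this
  have hqf : q f = 0 := by
    refine degPart_zero _ h hα _ ?_ ?_
    · intro P hP v hv hvP
      rw [hqe]
      exact (mem_emb Γ₀ f).1 hf v hv (by rw [hvP]; exact hP)
    · have := hd.aeval (Fin.cons 0 (fun i => X i) : Fin (m + 1 + 1) → MvPolynomial (Fin (m + 1)) K)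
        (n := 1) (by
          intro i
          refine Fin.cases ?_ (fun i => ?_) i
          · simpa using isHomogeneous_zero _ _ _
          · simpa using isHomogeneous_X _ _)
      rw [one_mul] at this
      exact this
  rw [hq, AlgHom.comp_apply, hqf, map_zero]

open Classical in
lemma psi2_of_mem [Infinite K] {n β d : ℕ} (hn : 1 ≤ n) (u : Fin β → K) (hu : Function.Injective u)
    (hdβ : d < β) (f : MvPolynomial (Fin (n + 1)) K)
    (hf : f ∈ vanishingIdeal (Finset.univ.image (fun i => linePt n (u i)) : Finset _))
    (hd : f.IsHomogeneous d) : psi2 n f = 0 := by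
  let p : Polynomial K := aeval (fun j : Fin (n + 1) => if (j : ℕ) = 1 then Polynomial.X else 1) f
  have hpe : ∀ c, p.eval c = eval (lv n c) f := by
    intro c
    have : (Polynomial.aeval c).comp (aeval (fun j : Fin (n + 1) =>
        if (j : ℕ) = 1 then (Polynomial.X : Polynomial K) else 1)) = aeval (lv n c) := by
      apply MvPolynomial.algHom_ext
      intro i
      simp only [AlgHom.comp_apply, aeval_X, lv]
      split_ifs <;> simp
    have := congrArg (fun φ => φ f) this
    simpa [coe_aeval_eq_eval, Polynomial.coe_aeval_eq_eval] using this
  have hdeg : p.natDegree ≤ d := by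
    have h1 := aeval_natDegree_le f (m := d) hd.totalDegree_le
      (fun j : Fin (n + 1) => if (j : ℕ) = 1 then (Polynomial.X : Polynomial K) else 1)
      (n := 1) (by
        intro i; split_ifs <;> simp)
    simpa using h1
  have hp : p = 0 := by
    apply Polynomial.eq_zero_of_natDegree_lt_card_of_eval_eq_zero p hu
    · intro i
      rw [hpe]
      simpa using (mem_line u f).1 hf i 1 one_ne_zero
    · simpa using lt_of_le_of_lt hdeg hdβ
  have h2 : X 0 * psi2 n f = 0 := by
    apply MvPolynomial.funext
    intro w
    rw [map_mul, map_zero, eval_X]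
    by_cases hw : w 0 = 0
    · simp [hw]
    · rw [eval_psi2]
      have : (fun i : Fin (n + 1) => if 2 ≤ (i : ℕ) then w 0 else w i) =
          w 0 • lv n (w 1 / w 0) := by
        funext i
        simp only [Pi.smul_apply, lv, smul_eq_mul]
        by_cases h1 : (i : ℕ) = 1
        · have hi : i = 1 := by
            ext; rw [h1]; simp [Fin.val_one', Nat.mod_eq_of_lt (show 1 < n + 1 by omega)]
          rw [if_neg (by omega), if_pos h1, hi]
          field_simp
        · rw [if_neg h1]
          split_ifs with h3
          · simp
          · have hi : i = 0 := Fin.ext (by rw [Fin.val_zero]; omega)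
            simp [hi]
      rw [this, hom_eval_smul hd, ← hpe, hp]
      simp
  rcases mul_eq_zero.1 h2 with h | h
  · exact absurd h (X_ne_zero _)
  · exact h

end geom

section final
variable {m : ℕ}


lemma psi1_X (i : Fin (m + 2 + 1)) (hi : i ≠ 0) : psi1 (m + 2) (X i : MvPolynomial (Fin (m + 2 + 1)) K) = X i := by
  simp [psi1, hi]

lemma psi1_X0 : psi1 (m + 2) (X 0 : MvPolynomial (Fin (m + 2 + 1)) K) = 0 := by
  simp [psi1]

lemma psi2_X0 : psi2 (m + 2) (X 0 : MvPolynomial (Fin (m + 2 + 1)) K) = X 0 := by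
  simp [psi2]

lemma psi2_X1 : psi2 (m + 2) (X 1 : MvPolynomial (Fin (m + 2 + 1)) K) = X 1 := by
  simp [psi2]

lemma psi2_X (i : Fin (m + 2 + 1)) (hi : 2 ≤ (i : ℕ)) : psi2 (m + 2) (X i : MvPolynomial (Fin (m + 2 + 1)) K) = X 0 := by
  simp [psi2, hi]

lemma psi1_psi2_psi1 (f : MvPolynomial (Fin (m + 2 + 1)) K) : psi1 (m + 2) (psi2 (m + 2) (psi1 (m + 2) f)) =
    psi1 (m + 2) (psi2 (m + 2) f) := by
  have : ((psi1 (K := K) (m + 2)).comp (psi2 (m + 2))).comp (psi1 (m + 2)) =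
      (psi1 (m + 2)).comp (psi2 (m + 2)) := by
    apply MvPolynomial.algHom_ext
    intro i
    simp only [AlgHom.comp_apply]
    by_cases hi : i = 0
    · subst hi
      rw [psi1_X0, psi2_X0, psi1_X0, map_zero, map_zero]
    · rw [psi1_X i hi]
  exact congrArg (fun φ => φ f) this

lemma psi1_psi1 (f : MvPolynomial (Fin (m + 2 + 1)) K) : psi1 (m + 2) (psi1 (m + 2) f) = psi1 (m + 2) f := by
  have : (psi1 (K := K) (m + 2)).comp (psi1 (m + 2)) = psi1 (m + 2) := by
    apply MvPolynomial.algHom_ext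
    intro i
    simp only [AlgHom.comp_apply]
    by_cases hi : i = 0
    · subst hi
      rw [psi1_X0, map_zero]
    · rw [psi1_X i hi, psi1_X i hi]
  exact congrArg (fun φ => φ f) this

lemma psi2_psi2 (f : MvPolynomial (Fin (m + 2 + 1)) K) : psi2 (m + 2) (psi2 (m + 2) f) = psi2 (m + 2) f := by
  have : (psi2 (K := K) (m + 2)).comp (psi2 (m + 2)) = psi2 (m + 2) := by
    apply MvPolynomial.algHom_ext
    intro i
    simp only [AlgHom.comp_apply]
    by_cases hi : 2 ≤ (i : ℕ)
    · rw [psi2_X i hi, psi2_X0]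
    · have : psi2 (m + 2) (X i : MvPolynomial (Fin (m + 2 + 1)) K) = X i := by simp [psi2, hi]
      rw [this, this]
  exact congrArg (fun φ => φ f) this

lemma psi1_psi2_ne (c : Fin (m + 2 + 1) → K) (h1 : c 1 ≠ 0) :
    psi1 (m + 2) (psi2 (m + 2) (ell c)) ≠ 0 := by
  intro h
  have h2 : psi1 (m + 2) (psi2 (m + 2) (ell c)) = C (c 1) * X 1 := by
    rw [ell, map_sum, map_sum, Finset.sum_eq_single 1]
    · rw [map_mul, map_mul, psi2_X1, psi1_X 1 (by simp)]
      simp [psi1, psi2]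
    · intro i _ hi
      by_cases h2 : 2 ≤ (i : ℕ)
      · rw [map_mul, map_mul, psi2_X i h2, psi1_X0, mul_zero]
      · have hi : i = 0 := by
          have : (i : ℕ) ≠ 1 := fun h => hi (Fin.ext (by simpa using h))
          exact Fin.ext (by rw [Fin.val_zero]; omega)
        subst hi
        rw [map_mul, map_mul, psi2_X0, psi1_X0, mul_zero]
    · simp
  rw [h2] at h
  rcases mul_eq_zero.1 h with h | h
  · exact h1 (by simpa using h)
  · exact X_ne_zero _ h

lemma div_aux {σ : Type} (i j : σ) (hij : i ≠ j) (a G H1 H2 : MvPolynomial σ K) (ha : a ≠ 0)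
    (e1 : X i * G = a * H1) (e2 : X j * G = a * H2) : ∃ h, G = a * h := by
  have e3 : X i * H2 = X j * H1 := by
    apply mul_left_cancel₀ ha
    linear_combination X j * e1 - X i * e2
  have e4 : (X i : MvPolynomial σ K) ∣ X j * H1 := ⟨H2, e3.symm⟩
  rcases (X_prime (R := K) (i := i)).dvd_or_dvd e4 with h | h
  · exact absurd (X_dvd_X.1 h) hij
  · obtain ⟨h, rfl⟩ := h
    refine ⟨h, mul_left_cancel₀ (X_ne_zero (R := K) i) ?_⟩
    rw [e1]; ring

section
variable {β : ℕ} (I I1 I2 : Ideal (MvPolynomial (Fin (m + 2 + 1)) K))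
  (hI : ∀ f, f ∈ I ↔ f ∈ I1 ∧ f ∈ I2)
  (g1 : ∀ f ∈ I1, ∀ d, homogeneousComponent d f ∈ I1)
  (g2 : ∀ f ∈ I2, ∀ d, homogeneousComponent d f ∈ I2)
  (m1 : ∀ f, psi1 (m + 2) f = 0 → f ∈ I1) (m2 : ∀ f, psi2 (m + 2) f = 0 → f ∈ I2)
  (k1 : ∀ d < β, ∀ f ∈ I1, f.IsHomogeneous d → psi1 (m + 2) f = 0)
  (k2 : ∀ d < β, ∀ f ∈ I2, f.IsHomogeneous d → psi2 (m + 2) f = 0)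
  (c : Fin (m + 2 + 1) → K) (h1 : c 1 ≠ 0)

include hI g1 g2 m1 m2 k1 k2 h1 in
lemma lower_aux (D : ℕ) (hD : D + 1 < β) (g : MvPolynomial (Fin (m + 2 + 1)) K)
    (hg : g.IsHomogeneous D)
    (h : ∀ k, X k * g ∈ I ⊔ Ideal.span {ell c}) : g ∈ I ⊔ Ideal.span {ell c} := by
  have key : ∀ k, ∃ h', psi1 (m + 2) (X k * g) = psi1 (m + 2) (ell c) * psi1 (m + 2) h' ∧
      psi2 (m + 2) (X k * g) = psi2 (m + 2) (ell c) * psi2 (m + 2) h' := by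
    intro k
    obtain ⟨f, hf, y, hy, hfy⟩ := Submodule.mem_sup.1 (h k)
    obtain ⟨t, rfl⟩ := Ideal.mem_span_singleton.1 hy
    have e0 : homogeneousComponent (1 + D) (X k * g) = X k * g := by
      rw [hcomp_mul (isHomogeneous_X _ _)]
      rw [homogeneousComponent_eq_self ((mem_homogeneousSubmodule _ _).2 hg)]
    rw [← hfy, map_add, hcomp_mul (ell_hom c), hfy] at e0
    have a1 := k1 (1 + D) (by omega) _ (g1 f ((hI f).1 hf).1 (1 + D))
      (homogeneousComponent_isHomogeneous _ _)
    have a2 := k2 (1 + D) (by omega) _ (g2 f ((hI f).1 hf).2 (1 + D))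
      (homogeneousComponent_isHomogeneous _ _)
    refine ⟨homogeneousComponent D t, ?_, ?_⟩
    · rw [← e0, map_add, a1, zero_add, map_mul]
    · rw [← e0, map_add, a2, zero_add, map_mul]
  have hne := psi1_psi2_ne c h1
  have hne2 : psi2 (m + 2) (ell c) ≠ 0 := fun h => hne (by rw [h, map_zero])
  have hne1 : psi1 (m + 2) (ell c) ≠ 0 := fun h => hne (by
    rw [← psi1_psi2_psi1, h, map_zero, map_zero])
  have hv2 : ((2 : Fin (m + 2 + 1)) : ℕ) = 2 := Nat.mod_eq_of_lt (show 2 < m + 2 + 1 by omega)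
  have h20 : (2 : Fin (m + 2 + 1)) ≠ 0 := fun h => by
    have := congrArg Fin.val h
    rw [hv2, Fin.val_zero] at this
    omega
  have h21 : (1 : Fin (m + 2 + 1)) ≠ 2 := fun h => by
    have := congrArg Fin.val h
    rw [hv2, Fin.val_one] at this
    omega
  obtain ⟨t0, -, b0⟩ := key 0
  obtain ⟨t1, a1, b1⟩ := key 1
  obtain ⟨t2, a2, -⟩ := key 2
  rw [map_mul, psi2_X0] at b0
  rw [map_mul, psi2_X1] at b1
  rw [map_mul, psi1_X 1 (by simp)] at a1
  rw [map_mul, psi1_X 2 h20] at a2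
  obtain ⟨p, hp⟩ := div_aux 1 2 h21 _ _ _ _ hne1 a1 a2
  obtain ⟨q, hq⟩ := div_aux 0 1 (by simp) _ _ _ _ hne2 b0 b1
  have hpq : psi1 (m + 2) (psi2 (m + 2) (p - q)) = 0 := by
    apply mul_left_cancel₀ hne
    have u1 := congrArg (fun z => psi1 (m + 2) (psi2 (m + 2) z)) hp
    have u2 := congrArg (fun z => psi1 (m + 2) (psi2 (m + 2) z)) hq
    simp only [map_mul, psi1_psi2_psi1, psi2_psi2] at u1 u2
    rw [map_sub, map_sub, mul_zero, mul_sub, ← u1, ← u2, sub_self]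
  have hp' : psi1 (m + 2) g = psi1 (m + 2) (ell c) * psi1 (m + 2) p := by
    have := congrArg (psi1 (m + 2)) hp
    rwa [psi1_psi1, map_mul, psi1_psi1] at this
  have hq' : psi2 (m + 2) g = psi2 (m + 2) (ell c) * psi2 (m + 2) q := by
    have := congrArg (psi2 (m + 2)) hq
    rwa [psi2_psi2, map_mul, psi2_psi2] at this
  have hmem : g - ell c * (p - psi2 (m + 2) (p - q)) ∈ I := by
    rw [hI]
    constructor
    · apply m1
      rw [map_sub, map_mul, map_sub, hpq, hp', sub_zero, sub_self]
    · apply m2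
      rw [map_sub, map_mul, map_sub (psi2 (m + 2)) p, psi2_psi2, map_sub, hq']
      ring
  refine Submodule.mem_sup.2 ⟨_, hmem, _,
    Ideal.mem_span_singleton.2 ⟨p - psi2 (m + 2) (p - q), rfl⟩, ?_⟩
  ring

include hI g1 g2 m1 m2 k1 k2 h1 in
lemma upper_aux (b : ℕ) (hb : β = b + 1) 
    (hP : (-X 1) ^ β ∈ I1 ⊔ I2)
    (r1 : ∀ f, ell c * f ∈ I1 → f ∈ I1) (r2 : ∀ f, ell c * f ∈ I2 → f ∈ I2) :
    ∃ g, g.IsHomogeneous β ∧ g ∉ I ⊔ Ideal.span {ell c} ∧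
      ∀ k, X k * g ∈ I ⊔ Ideal.span {ell c} := by
  have hX0 : (X 0 : MvPolynomial (Fin (m + 2 + 1)) K) ∈ I1 := m1 _ psi1_X0
  have hk : ∀ k : Fin (m + 2 + 1), (X k * X 1 ^ b : MvPolynomial (Fin (m + 2 + 1)) K) ∈ I1 ⊔ I2 := by
    intro k
    by_cases h0 : k = 0
    · subst h0
      exact Ideal.mul_mem_right _ _ (Submodule.mem_sup_left hX0)
    by_cases hk1 : k = 1
    · subst hk1
      have : (X 1 * X 1 ^ b : MvPolynomial (Fin (m + 2 + 1)) K) = (-1) ^ β * (-X 1) ^ β := by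
        rw [← mul_pow, neg_one_mul, neg_neg, hb, pow_succ']
      rw [this]
      exact Ideal.mul_mem_left _ _ hP
    · have hk2 : 2 ≤ (k : ℕ) := by
        have a1 : (k : ℕ) ≠ 0 := fun h => h0 (Fin.ext (by simpa using h))
        have a2 : (k : ℕ) ≠ 1 := fun h => hk1 (Fin.ext (by simpa using h))
        omega
      have h3 : (X k - X 0 : MvPolynomial (Fin (m + 2 + 1)) K) ∈ I2 := m2 _ (by rw [map_sub, psi2_X k hk2, psi2_X0, sub_self])
      have : (X k : MvPolynomial (Fin (m + 2 + 1)) K) ∈ I1 ⊔ I2 := by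
        have := add_mem (Submodule.mem_sup_left (T := I2) hX0)
          (Submodule.mem_sup_right (S := I1) h3)
        simpa using this
      exact Ideal.mul_mem_right _ _ this
  have hell : ell c * X 1 ^ b ∈ I1 ⊔ I2 := by
    rw [ell, Finset.sum_mul]
    refine sum_mem fun i _ => ?_
    rw [mul_assoc]
    exact Ideal.mul_mem_left _ _ (hk i)
  obtain ⟨p, hp, q, hq, hpq⟩ := Submodule.mem_sup.1 hell
  have hX1 : (X 1 ^ b : MvPolynomial (Fin (m + 2 + 1)) K).IsHomogeneous b := isHomogeneous_X_pow _ _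
  have e0 : homogeneousComponent (1 + b) p + homogeneousComponent (1 + b) q = ell c * X 1 ^ b := by
    rw [← map_add, hpq, hcomp_mul (ell_hom c),
      homogeneousComponent_eq_self ((mem_homogeneousSubmodule _ _).2 hX1)]
  have hp' := g1 p hp (1 + b)
  have hq' := g2 q hq (1 + b)
  have hph : (homogeneousComponent (1 + b) p).IsHomogeneous (1 + b) :=
    homogeneousComponent_isHomogeneous _ _
  generalize homogeneousComponent (1 + b) p = P at *
  generalize homogeneousComponent (1 + b) q = Q at *
  refine ⟨P, by rw [show β = 1 + b by omega]; exact hph, ?_, ?_⟩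
  · intro hmem
    obtain ⟨f, hf, y, hy, hfy⟩ := Submodule.mem_sup.1 hmem
    obtain ⟨t, rfl⟩ := Ideal.mem_span_singleton.1 hy
    have e1 : homogeneousComponent (1 + b) P = P :=
      homogeneousComponent_eq_self ((mem_homogeneousSubmodule _ _).2 hph)
    rw [← hfy, map_add, hcomp_mul (ell_hom c), hfy] at e1
    have f1 := g1 f ((hI f).1 hf).1 (1 + b)
    have f2 := g2 f ((hI f).1 hf).2 (1 + b)
    generalize homogeneousComponent (1 + b) f = F at *
    have hTh : (homogeneousComponent b t).IsHomogeneous b := homogeneousComponent_isHomogeneous _ _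
    generalize homogeneousComponent b t = T at *
    have t1 : T ∈ I1 := by
      apply r1
      have : ell c * T = P - F := by rw [← e1]; ring
      rw [this]
      exact sub_mem hp' f1
    have t2 : X 1 ^ b - T ∈ I2 := by
      apply r2
      have : ell c * (X 1 ^ b - T) = Q + F := by
        rw [mul_sub, ← e0, ← e1]; ring
      rw [this]
      exact add_mem hq' f2
    have s1 := k1 b (by omega) _ t1 hTh
    have s2 := k2 b (by omega) _ t2 (hX1.sub hTh)
    have s3 : psi1 (m + 2) (psi2 (m + 2) T) = 0 := by
      rw [← psi1_psi2_psi1, s1, map_zero, map_zero]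
    have s4 := congrArg (psi1 (m + 2)) s2
    rw [map_sub, map_sub, s3, map_zero, sub_zero, map_pow, map_pow, psi2_X1,
      psi1_X 1 (by simp)] at s4
    exact pow_ne_zero _ (X_ne_zero _) s4
  · intro k
    obtain ⟨pk, hpk, qk, hqk, hk'⟩ := Submodule.mem_sup.1 (hk k)
    have hmem : X k * P - ell c * pk ∈ I := by
      rw [hI]
      constructor
      · exact sub_mem (Ideal.mul_mem_left _ _ hp') (Ideal.mul_mem_left _ _ hpk)
      · have : X k * P - ell c * pk = ell c * qk - X k * Q := by
          linear_combination X k * e0 - ell c * hk'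
        rw [this]
        exact sub_mem (Ideal.mul_mem_left _ _ hqk) (Ideal.mul_mem_left _ _ hq')
    refine Submodule.mem_sup.2 ⟨_, hmem, _, Ideal.mem_span_singleton.2 ⟨pk, rfl⟩, ?_⟩
    ring
end

open Classical in
lemma prod_mem {n β : ℕ} (hn : 1 ≤ n) (u : Fin β → K) : prodPoly n β u ∈
    vanishingIdeal (Finset.univ.image (fun i => linePt n (u i)) : Finset _) := by
  rw [mem_line]
  intro i a _
  rw [prodPoly, map_prod]
  refine Finset.prod_eq_zero (Finset.mem_univ i) ?_
  have h1 : ((1 : Fin (n + 1)) : ℕ) = 1 := Nat.mod_eq_of_lt (show 1 < n + 1 by omega)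
  simp only [map_sub, map_mul, eval_C, eval_X, Pi.smul_apply, lv, h1, smul_eq_mul, if_true,
    Fin.val_zero]
  simp [mul_comm]

lemma psi1_prod {β : ℕ} (u : Fin β → K) : psi1 (m + 2) (prodPoly (m + 2) β u) = (-X 1) ^ β := by
  rw [prodPoly, map_prod]
  simp [psi1_X0, psi1_X 1]

lemma psi1_neg (β : ℕ) : psi1 (m + 2) ((-X 1 : MvPolynomial (Fin (m + 2 + 1)) K) ^ β) = (-X 1) ^ β := by
  simp [psi1_X 1]

lemma ell_eval {n : ℕ} (c v : Fin (n + 1) → K) : eval v (ell c) = ∑ i, c i * v i := by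
  simp [ell]

lemma exists_c [Infinite K] {n : ℕ} (Γ : Finset (Projectivization K (Fin (n + 1) → K))) :
    ∃ c : Fin (n + 1) → K, c 0 ≠ 0 ∧ c 1 ≠ 0 ∧ ∀ P ∈ Γ, ∑ i, c i * P.rep i ≠ 0 := by
  let p : MvPolynomial (Fin (n + 1)) K := X 0 * X 1 * ∏ P ∈ Γ, ell P.rep
  have hp : p ≠ 0 := by
    refine mul_ne_zero (mul_ne_zero (X_ne_zero _) (X_ne_zero _)) (Finset.prod_ne_zero_iff.2 ?_)
    intro P _ h
    apply P.rep_nonzero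
    funext i
    have := congrArg (eval (Pi.single i 1)) h
    simpa [ell_eval, Pi.single_apply] using this
  by_contra hcon
  push Not at hcon
  apply hp
  apply MvPolynomial.funext
  intro c
  simp only [p, map_mul, eval_X, map_zero, map_prod]
  by_cases h0 : c 0 = 0
  · simp [h0]
  by_cases h1 : c 1 = 0
  · simp [h1]
  obtain ⟨P, hP, hz⟩ := hcon c h0 h1
  rw [Finset.prod_eq_zero hP, mul_zero]
  rw [ell_eval, ← hz]
  exact Finset.sum_congr rfl fun i _ => mul_comm _ _

lemma ell_reg {n : ℕ} (Γ : Set (Projectivization K (Fin (n + 1) → K))) (c : Fin (n + 1) → K)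
    (h : ∀ P ∈ Γ, ∑ i, c i * P.rep i ≠ 0) (f : MvPolynomial (Fin (n + 1)) K)
    (hf : ell c * f ∈ vanishingIdeal Γ) : f ∈ vanishingIdeal Γ := by
  intro P hP v hv hvP
  have h1 := hf P hP v hv hvP
  rw [map_mul] at h1
  refine (mul_eq_zero.1 h1).resolve_left fun h2 => h P hP ?_
  have h3 : Projectivization.mk K v hv = Projectivization.mk K P.rep P.rep_nonzero := by
    rw [Projectivization.mk_rep, hvP]
  obtain ⟨a, ha⟩ := (Projectivization.mk_eq_mk_iff' K _ _ _ _).1 h3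
  have ha0 : a ≠ 0 := by rintro rfl; apply hv; rw [← ha]; simp
  rw [← ha, ell_eval] at h2
  have : a * ∑ i, c i * P.rep i = 0 := by
    rw [← h2, Finset.mul_sum]
    refine Finset.sum_congr rfl fun i _ => ?_
    simp only [Pi.smul_apply, smul_eq_mul]
    ring
  exact (mul_eq_zero.1 this).resolve_left ha0

end final
/-- In the Migliore construction with `α ≥ β + n - 2`, if
`s ≥ β` then the minimum socle degree satisfies `A_n = β` or `A_n = β - 1`. -/
theorem migliore_s_ge_beta
    {K : Type} [Field K] [CharZero K] {n α β : ℕ} (hn : 2 ≤ n)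
    (hα : 0 < α) (hβ : 0 < β)
    (Γ₀ : Finset (Projectivization K (Fin n → K)))
    (hcard : Γ₀.card = α)
    (hgen : ∀ i, HF (vanishingIdeal (Γ₀ : Set (Projectivization K (Fin n → K)))) i =
      min ((i + n - 1).choose (n - 1)) α)
    (u : Fin β → K) (hu : Function.Injective u)
    (s : ℕ) (hs : α < (s + n - 1).choose (n - 1))
    (hsmin : ∀ j, α < (j + n - 1).choose (n - 1) → s ≤ j)
    (v : ℕ) (hvs : v = s ∨ v = s + 1)
    (hv : vanishingIdeal (Γ₀ : Set (Projectivization K (Fin n → K))) ⊔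
        Ideal.span {f | ∃ i : Fin n, 1 ≤ (i : ℕ) ∧ f = X i} =
      Ideal.span ({X (⟨0, by omega⟩ : Fin n) ^ v} ∪ {f | ∃ i : Fin n, 1 ≤ (i : ℕ) ∧ f = X i}))
    (hαβ : β + n - 2 ≤ α)
    (hhyp : hyp (MigGamma Γ₀ u) = α)
    (res : MinFreeRes (n + 1) K
      (vanishingIdeal ((MigGamma Γ₀ u) : Set (Projectivization K (Fin (n + 1) → K)))))
    (hlen : res.len = n)
    (hsβ : β ≤ s) :
    res.A = (β : ℤ) ∨ res.A = (β : ℤ) - 1 := by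
  classical
  obtain ⟨m, rfl⟩ : ∃ m, n = m + 2 := ⟨n - 2, by omega⟩
  have hinf : Infinite K := Infinite.of_injective (Nat.cast : ℕ → K) Nat.cast_injective
  obtain ⟨c, hc0, hc1, hcP⟩ := exists_c (MigGamma Γ₀ u)
  have hI := mem_mig Γ₀ u
  have k1 : ∀ d < β, ∀ f ∈ vanishingIdeal
      ((Γ₀.image embedPt : Finset _) : Set (Projectivization K (Fin (m + 2 + 1) → K))),
      f.IsHomogeneous d → psi1 (m + 2) f = 0 := by
    intro d hd f hf hfd
    refine psi1_of_mem Γ₀ (hgen d) ?_ f hf hfd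
    by_contra hcon
    have := hsmin d (by simpa using hcon)
    omega
  have k2 := fun d (hd : d < β) f hf hfd =>
    psi2_of_mem (n := m + 2) (d := d) (by omega) u hu hd f hf hfd
  have hreg := ell_reg _ c (fun P hP => hcP P (Finset.mem_coe.1 hP))
  have r1 := ell_reg ((Γ₀.image embedPt : Finset _) :
    Set (Projectivization K (Fin (m + 2 + 1) → K))) c
    (fun P hP => hcP P (Finset.mem_union_left _ (Finset.mem_coe.1 hP)))
  have r2 := ell_reg ((Finset.univ.image (fun i => linePt (m + 2) (u i)) : Finset _) :
    Set (Projectivization K (Fin (m + 2 + 1) → K))) c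
    (fun P hP => hcP P (Finset.mem_union_right _ (Finset.mem_coe.1 hP)))
  have hsoc := res_socle res (by omega) hlen c hc0 hreg
  have hup : ∃ i, res.twist (m + 2) i = β + (m + 2) := by
    rw [hsoc]
    refine upper_aux _ _ _ hI (fun f hf d => vanish_hom _ f hf d)
      (fun f hf d => vanish_hom _ f hf d) (mem_emb_of_psi1 Γ₀) (mem_line_of_psi2 u) k1 k2 c hc1
      (β - 1) (by omega) ?_ r1 r2
    have a1 := mem_emb_of_psi1 Γ₀ ((-X 1) ^ β - prodPoly (m + 2) β u)
      (by rw [map_sub, psi1_prod, psi1_neg, sub_self])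
    exact Submodule.mem_sup.2 ⟨_, a1, _, prod_mem (by omega) u, by ring⟩
  have hlow : ∀ i, m + 2 + β ≤ res.twist (m + 2) i + 1 := by
    intro i
    have h2 : m + 2 ≤ res.twist (m + 2) i := le_tt res (m + 2) i
    by_contra hcon
    obtain ⟨g, hg, hgn, hgk⟩ := (hsoc (res.twist (m + 2) i - (m + 2))).1 ⟨i, by omega⟩
    exact hgn (lower_aux _ _ _ hI (fun f hf d => vanish_hom _ f hf d)
      (fun f hf d => vanish_hom _ f hf d) (mem_emb_of_psi1 Γ₀) (mem_line_of_psi2 u) k1 k2 c hc1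
      _ (by omega) g hg hgk)
  have key : ∀ k, k = m + 2 → (∃ i, res.twist k i = β + k) ∧
      ∀ i, k + β ≤ res.twist k i + 1 := by
    rintro _ rfl
    exact ⟨hup, hlow⟩
  clear hup hlow
  obtain ⟨hup, hlow⟩ := key _ hlen
  obtain ⟨i, hi⟩ := hup
  have h1 : res.aMin ≤ β + res.len := by
    rw [← hi]
    exact Finset.inf'_le _ (Finset.mem_univ i)
  have h2 : res.len + β ≤ res.aMin + 1 := by
    obtain ⟨j, _, hj⟩ := Finset.exists_mem_eq_inf'
      (Finset.univ_nonempty_iff.mpr (Fin.pos_iff_nonempty.mp res.rk_len_pos))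
      (fun i => res.twist res.len i)
    have := hlow j
    rw [MinFreeRes.aMin, hj]
    exact this
  unfold MinFreeRes.A
  omega

end PointsMinDist
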